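/- arXiv:1707.02675 — 2 statements merged into one kernel-verified Lean document; each statement's English description precedes it below -/
import Mathlib

section
/- Let n ≥ 1 and let A and B be n×n complex matrices. Then det [[A, B], [conj(B), conj(A)]] = (det R : ℂ), where R is the real 2n×2n block matrix R = [[re(A+B), −im(A−B)], [im(A+B), re(A−B)]] whose blocks are formed by taking entrywise real parts re(·) and imaginary parts im(·). In particular, the determinant of the complex power flow Jacobian J^Z = [[∂S/∂I, ∂S/∂I*], [∂S*/∂I, ∂S*/∂I*]] equals the determinant of the real rectangular-coordinate power flow Jacobian J^R = [[∂P/∂I_D, ∂P/∂I_Q], [∂Q/∂I_D, ∂Q/∂I_Q]]. -/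
open Matrix Complex

/-- The change of coordinates `(z, conj z) ↦ (re z, im z)` as a block matrix. -/
noncomputable def wirtingerToRect (ι : Type*) [DecidableEq ι] : Matrix (ι ⊕ ι) (ι ⊕ ι) ℂ :=
  fromBlocks ((1 / 2 : ℂ) • 1) ((1 / 2 : ℂ) • 1) ((-I / 2) • 1) ((I / 2) • 1)

/-- The change of coordinates `(re z, im z) ↦ (z, conj z)` as a block matrix. -/
noncomputable def rectToWirtinger (ι : Type*) [DecidableEq ι] : Matrix (ι ⊕ ι) (ι ⊕ ι) ℂ :=
  fromBlocks 1 (I • 1) 1 (-I • 1)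

theorem wirtingerToRect_mul_rectToWirtinger (ι : Type*) [Fintype ι] [DecidableEq ι] :
    wirtingerToRect ι * rectToWirtinger ι = 1 := by
  rw [wirtingerToRect, rectToWirtinger, fromBlocks_multiply, ← fromBlocks_one]
  simp only [Matrix.smul_mul, Matrix.one_mul, smul_smul, ← add_smul]
  congr 1
  · norm_num
  · ring_nf; simp
  · ring_nf; simp
  · ring_nf; simp

theorem wirtingerToRect_mul_fromBlocks_conj_mul_rectToWirtinger {ι : Type*} [Fintype ι]
    [DecidableEq ι] (A B : Matrix ι ι ℂ) :
    wirtingerToRect ι * fromBlocks A B (B.map (starRingEnd ℂ)) (A.map (starRingEnd ℂ)) *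
        rectToWirtinger ι =
      (fromBlocks ((A + B).map re) (-((A - B).map im)) ((A + B).map im)
        ((A - B).map re)).map ofRealHom := by
  rw [wirtingerToRect, rectToWirtinger, fromBlocks_multiply, fromBlocks_multiply, fromBlocks_map]
  congr 1 <;> ext i j <;> apply Complex.ext <;> simp <;> ring

theorem stmt_1 (n : ℕ) (hn : 1 ≤ n) (A B : Matrix (Fin n) (Fin n) ℂ)
    (R : Matrix (Fin n ⊕ Fin n) (Fin n ⊕ Fin n) ℝ)
    (hR : R = Matrix.fromBlocks
      ((A + B).map Complex.re)
      (-((A - B).map Complex.im))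
      ((A + B).map Complex.im)
      ((A - B).map Complex.re)) :
    (Matrix.fromBlocks A B (B.map (starRingEnd ℂ)) (A.map (starRingEnd ℂ))).det
      = (R.det : ℂ) := by
  have h_inv := congrArg det (wirtingerToRect_mul_rectToWirtinger (Fin n))
  have h_conj := congrArg det (wirtingerToRect_mul_fromBlocks_conj_mul_rectToWirtinger A B)
  rw [det_mul, det_one] at h_inv
  rw [← hR, ← RingHom.mapMatrix_apply ofRealHom, ← RingHom.map_det, ofRealHom_eq_coe,
    det_mul, det_mul, mul_right_comm, h_inv, one_mul] at h_conj
  exact h_conj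
end

section
/- Fix n ≥ 1. Let Z be an n×n complex matrix, and let I, E ∈ ℂⁿ with I_i ≠ 0 for every i. Define V ∈ ℂⁿ by V_h = E_h − Σ_{j=1}^n Z_{hj}·I_j, define n×n complex matrices A and B by A_{hi} = −Z_{hi}·conj(I_h) and B_{hi} = −Z_{hi}·I_i, and let D = diag(V₁,…,Vₙ). Then the determinant of the complex power flow Jacobian J^Z = [[A, D], [conj(D), conj(A)]] satisfies det J^Z = (−1)ⁿ · det J^{Z′}, where J^{Z′} = [[D, B], [conj(B), conj(D)]] and conj(M) denotes the entrywise complex conjugate of M. -/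
open Matrix Complex

/-- Exchanging the two block columns of a block matrix with square blocks multiplies the
determinant by `(-1) ^ card m`. -/
theorem det_fromBlocks_swap_columns {m R : Type*} [Fintype m] [DecidableEq m] [CommRing R]
    (A B C D : Matrix m m R) :
    (fromBlocks B A D C).det = (-1) ^ Fintype.card m * (fromBlocks A B C D).det := by
  have hswap : (fromBlocks 0 (1 : Matrix m m R) (1 : Matrix m m R) 0).det = (-1) ^ Fintype.card m := by
    have hmul : fromBlocks 0 (1 : Matrix m m R) (1 : Matrix m m R) 0 *
          fromBlocks 1 0 1 1 =
        fromBlocks 1 1 1 0 := by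
      simp [fromBlocks_multiply]
    have hdet := congrArg det hmul
    rw [det_mul, det_fromBlocks_zero₁₂, det_fromBlocks_one₁₁] at hdet
    simpa [det_neg] using hdet
  have hmul : fromBlocks B A D C = fromBlocks A B C D * fromBlocks 0 1 1 0 := by
    simp [fromBlocks_multiply]
  rw [hmul, det_mul, hswap, mul_comm]

theorem stmt_5 (n : ℕ) (hn : 1 ≤ n) (Z : Matrix (Fin n) (Fin n) ℂ)
    (Iv E : Fin n → ℂ) (hI : ∀ i, Iv i ≠ 0)
    (V : Fin n → ℂ) (hV : ∀ h, V h = E h - ∑ j, Z h j * Iv j)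
    (A B : Matrix (Fin n) (Fin n) ℂ)
    (hA : ∀ h i, A h i = -Z h i * (starRingEnd ℂ) (Iv h))
    (hB : ∀ h i, B h i = -Z h i * Iv i)
    (D : Matrix (Fin n) (Fin n) ℂ) (hD : D = Matrix.diagonal V) :
    (Matrix.fromBlocks A D (D.map (starRingEnd ℂ)) (A.map (starRingEnd ℂ))).det =
    (-1 : ℂ) ^ n *
      (Matrix.fromBlocks D B (B.map (starRingEnd ℂ)) (D.map (starRingEnd ℂ))).det := by
  set P : Matrix (Fin n) (Fin n) ℂ := diagonal Iv
  set Q : Matrix (Fin n) (Fin n) ℂ := diagonal fun i => (starRingEnd ℂ) (Iv i)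
  have hconj : (fromBlocks D A (A.map (starRingEnd ℂ)) (D.map (starRingEnd ℂ))) *
        fromBlocks Q 0 0 P =
      fromBlocks Q 0 0 P *
        fromBlocks D B (B.map (starRingEnd ℂ)) (D.map (starRingEnd ℂ)) := by
    simp only [fromBlocks_multiply, Matrix.mul_zero, Matrix.zero_mul, add_zero, zero_add]
    congr 1 <;> ext h i <;>
      simp only [P, Q, mul_diagonal, diagonal_mul, map_apply, hA, hB, hD, diagonal_apply,
        map_mul, map_neg, conj_conj]
    · split_ifs with hi
      · rw [hi, mul_comm]
      · simp
    · ring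
    · ring
    · split_ifs with hi
      · rw [hi, mul_comm]
      · simp
  have hne : (fromBlocks Q 0 0 P).det ≠ 0 := by
    simp [P, Q, det_diagonal, Finset.prod_ne_zero_iff, hI]
  have hdet := congrArg det hconj
  rw [det_mul, det_mul, mul_comm] at hdet
  rw [det_fromBlocks_swap_columns, Fintype.card_fin, mul_left_cancel₀ hne hdet]
end
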